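/- arXiv:2209.11987 — 2 statements merged into one kernel-verified Lean document; each statement's English description precedes it below -/
import Mathlib

section
/- In the abstract framework, if σ < 1 then the coupled problem has at most one solution: if (u₁, θ₁) and (u₂, θ₂) in V × Z both satisfy a(uᵢ,v) + c(uᵢ,uᵢ,v) + Q(θᵢ,v) = L(v) for all v ∈ V and e(θᵢ,r) + h(uᵢ,θᵢ,r) = Ψ(r) for all r ∈ Z, then u₁ = u₂ and θ₁ = θ₂. (Uniqueness part of Theorem 2.3 of the paper.) -/
theorem mul_le_of_mul_sq_le_mul {k M x : ℝ} (hx : 0 ≤ x) (hM : 0 ≤ M)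
    (h : k * x ^ 2 ≤ M * x) : k * x ≤ M := by
  rcases hx.eq_or_lt with rfl | hx
  · simpa using hM
  · exact le_of_mul_le_mul_right (by linarith [show k * x * x = k * x ^ 2 by ring]) hx

theorem stmt_6
    {V Z : Type*} [NormedAddCommGroup V] [InnerProductSpace ℝ V] [CompleteSpace V]
    [NormedAddCommGroup Z] [InnerProductSpace ℝ Z] [CompleteSpace Z]
    (Cmin Cmax lam2 lamq Lam lampsi : ℝ)
    (hCmin : 0 < Cmin) (hCmax : 0 ≤ Cmax) (hlam2 : 0 ≤ lam2)
    (hlamq : 0 ≤ lamq) (hLam : 0 ≤ Lam) (hlampsi : 0 ≤ lampsi)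
    (a : V →ₗ[ℝ] V →ₗ[ℝ] ℝ) (e : Z →ₗ[ℝ] Z →ₗ[ℝ] ℝ)
    (c : V →ₗ[ℝ] V →ₗ[ℝ] V →ₗ[ℝ] ℝ) (h : V →ₗ[ℝ] Z →ₗ[ℝ] Z →ₗ[ℝ] ℝ)
    (Q : Z →ₗ[ℝ] V →ₗ[ℝ] ℝ) (L : V →ₗ[ℝ] ℝ) (Ψ : Z →ₗ[ℝ] ℝ)
    (ha_bdd : ∀ u v : V, |a u v| ≤ Cmax * ‖u‖ * ‖v‖)
    (ha_coer : ∀ v : V, Cmin * ‖v‖ ^ 2 ≤ a v v)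
    (he_bdd : ∀ θ r : Z, |e θ r| ≤ ‖θ‖ * ‖r‖)
    (he_coer : ∀ r : Z, ‖r‖ ^ 2 ≤ e r r)
    (hc_bdd : ∀ w u v : V, |c w u v| ≤ lam2 * ‖w‖ * ‖u‖ * ‖v‖)
    (hc_skew : ∀ w v : V, c w v v = 0)
    (hh_bdd : ∀ (w : V) (θ r : Z), |h w θ r| ≤ lam2 * ‖w‖ * ‖θ‖ * ‖r‖)
    (hh_skew : ∀ (w : V) (r : Z), h w r r = 0)
    (hQ_bdd : ∀ (θ : Z) (v : V), |Q θ v| ≤ lamq * ‖θ‖ * ‖v‖)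
    (hL_bdd : ∀ v : V, |L v| ≤ Lam * ‖v‖)
    (hPsi_bdd : ∀ r : Z, |Ψ r| ≤ lampsi * ‖r‖)
    (hsigma : (lam2 * Lam / Cmin ^ 2 + lam2 * lamq * lampsi / Cmin ^ 2 + lam2 * lamq * lampsi / Cmin + lam2 * Lam / Cmin) < 1)
    (u₁ u₂ : V) (θ₁ θ₂ : Z)
    (hu1 : ∀ v : V, a u₁ v + c u₁ u₁ v + Q θ₁ v = L v)
    (hu2 : ∀ v : V, a u₂ v + c u₂ u₂ v + Q θ₂ v = L v)
    (hθ1 : ∀ r : Z, e θ₁ r + h u₁ θ₁ r = Ψ r)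
    (hθ2 : ∀ r : Z, e θ₂ r + h u₂ θ₂ r = Ψ r) :
    u₁ = u₂ ∧ θ₁ = θ₂ := by
  have hθ₂_norm : ‖θ₂‖ ≤ lampsi := by
    have key : 1 * ‖θ₂‖ ^ 2 ≤ lampsi * ‖θ₂‖ := by
      linarith [hθ2 θ₂, hh_skew u₂ θ₂, he_coer θ₂, le_of_abs_le (hPsi_bdd θ₂)]
    simpa using mul_le_of_mul_sq_le_mul (norm_nonneg _) hlampsi key
  have hu₂_norm : Cmin * ‖u₂‖ ≤ Lam + lamq * lampsi := by
    refine mul_le_of_mul_sq_le_mul (norm_nonneg _) (by positivity) ?_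
    have hQ : lamq * ‖θ₂‖ * ‖u₂‖ ≤ lamq * lampsi * ‖u₂‖ := by gcongr
    linarith [hu2 u₂, hc_skew u₂ u₂, ha_coer u₂, le_of_abs_le (hL_bdd u₂),
      neg_le_of_abs_le (hQ_bdd θ₂ u₂)]
  have hθ_norm : ‖θ₁ - θ₂‖ ≤ lam2 * lampsi * ‖u₁ - u₂‖ := by
    have key : 1 * ‖θ₁ - θ₂‖ ^ 2 ≤ lam2 * lampsi * ‖u₁ - u₂‖ * ‖θ₁ - θ₂‖ := by
      have hh : lam2 * ‖u₁ - u₂‖ * ‖θ₂‖ * ‖θ₁ - θ₂‖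
          ≤ lam2 * ‖u₁ - u₂‖ * lampsi * ‖θ₁ - θ₂‖ := by gcongr
      have hcoer := he_coer (θ₁ - θ₂)
      have hbdd := neg_le_of_abs_le (hh_bdd (u₁ - u₂) θ₂ (θ₁ - θ₂))
      have hskew := hh_skew u₁ (θ₁ - θ₂)
      have h₁ := hθ1 (θ₁ - θ₂)
      have h₂ := hθ2 (θ₁ - θ₂)
      simp only [map_sub, LinearMap.sub_apply] at hcoer hbdd hskew h₁ h₂
      linarith
    simpa using mul_le_of_mul_sq_le_mul (norm_nonneg _) (by positivity) key
  have hu_norm : Cmin * ‖u₁ - u₂‖ ≤ lam2 * ‖u₁ - u₂‖ * ‖u₂‖ + lamq * ‖θ₁ - θ₂‖ := by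
    refine mul_le_of_mul_sq_le_mul (norm_nonneg _) (by positivity) ?_
    have hcoer := ha_coer (u₁ - u₂)
    have hc := neg_le_of_abs_le (hc_bdd (u₁ - u₂) u₂ (u₁ - u₂))
    have hQ := neg_le_of_abs_le (hQ_bdd (θ₁ - θ₂) (u₁ - u₂))
    have hskew := hc_skew u₁ (u₁ - u₂)
    have h₁ := hu1 (u₁ - u₂)
    have h₂ := hu2 (u₁ - u₂)
    simp only [map_sub, LinearMap.sub_apply] at hcoer hc hQ hskew h₁ h₂
    linarith
  have hsmall : lam2 * ((Lam + lamq * lampsi) / Cmin) + lamq * (lam2 * lampsi) < Cmin := by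
    have hrest : 0 ≤ lam2 * Lam / Cmin := by positivity
    have hlt : (lam2 * ((Lam + lamq * lampsi) / Cmin) + lamq * (lam2 * lampsi)) / Cmin < 1 := by
      calc _ = lam2 * Lam / Cmin ^ 2 + lam2 * lamq * lampsi / Cmin ^ 2
            + lam2 * lamq * lampsi / Cmin := by field_simp
        _ < 1 := by linarith
    simpa using (div_lt_iff₀ hCmin).1 hlt
  have hu : ‖u₁ - u₂‖ = 0 := by
    by_contra hne
    have hpos : 0 < ‖u₁ - u₂‖ := lt_of_le_of_ne (norm_nonneg _) (Ne.symm hne)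
    have hu₂ : ‖u₂‖ ≤ (Lam + lamq * lampsi) / Cmin := by
      rw [le_div_iff₀ hCmin]; linarith
    have h₁ : lam2 * ‖u₁ - u₂‖ * ‖u₂‖
        ≤ lam2 * ‖u₁ - u₂‖ * ((Lam + lamq * lampsi) / Cmin) := by gcongr
    have h₂ : lamq * ‖θ₁ - θ₂‖ ≤ lamq * (lam2 * lampsi * ‖u₁ - u₂‖) := by gcongr
    linarith [mul_lt_mul_of_pos_right hsmall hpos]
  have hθ : ‖θ₁ - θ₂‖ = 0 := by
    rw [hu, mul_zero] at hθ_norm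
    exact le_antisymm hθ_norm (norm_nonneg _)
  exact ⟨sub_eq_zero.1 (norm_eq_zero.1 hu), sub_eq_zero.1 (norm_eq_zero.1 hθ)⟩
end

section
/- (Unconditional stability of the Oseen iteration.) In the abstract framework, let (uⁿ)ₙ≥₁ ⊆ V and (θⁿ)ₙ≥₁ ⊆ Z satisfy, for every n ≥ 1 and some previous iterate uⁿ⁻¹ ∈ V: a(uⁿ,v) + c(uⁿ⁻¹,uⁿ,v) + Q(θⁿ,v) = L(v) for all v ∈ V and e(θⁿ,r) + h(uⁿ⁻¹,θⁿ,r) = Ψ(r) for all r ∈ Z. Then, without any smallness condition on σ, for every n ≥ 1 one has ‖θⁿ‖ ≤ λ_ψ and ‖uⁿ‖ ≤ C₀ = (Λ + λ_q·λ_ψ)/C_min. -/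
theorem le_div_of_mul_sq_le_mul {k b x : ℝ} (hk : 0 < k) (hb : 0 ≤ b) (hx : 0 ≤ x)
    (hkx : k * x ^ 2 ≤ b * x) : x ≤ b / k := by
  rcases hx.eq_or_lt with rfl | hx
  · positivity
  · rw [le_div_iff₀ hk]
    exact le_of_mul_le_mul_right (by linarith) hx

theorem stmt_15
    {V Z : Type*} [NormedAddCommGroup V] [InnerProductSpace ℝ V] [CompleteSpace V]
    [NormedAddCommGroup Z] [InnerProductSpace ℝ Z] [CompleteSpace Z]
    (Cmin Cmax lam2 lamq Lam lampsi : ℝ)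
    (hCmin : 0 < Cmin) (hCmax : 0 ≤ Cmax) (hlam2 : 0 ≤ lam2)
    (hlamq : 0 ≤ lamq) (hLam : 0 ≤ Lam) (hlampsi : 0 ≤ lampsi)
    (a : V →ₗ[ℝ] V →ₗ[ℝ] ℝ) (e : Z →ₗ[ℝ] Z →ₗ[ℝ] ℝ)
    (c : V →ₗ[ℝ] V →ₗ[ℝ] V →ₗ[ℝ] ℝ) (h : V →ₗ[ℝ] Z →ₗ[ℝ] Z →ₗ[ℝ] ℝ)
    (Q : Z →ₗ[ℝ] V →ₗ[ℝ] ℝ) (L : V →ₗ[ℝ] ℝ) (Ψ : Z →ₗ[ℝ] ℝ)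
    (ha_bdd : ∀ u v : V, |a u v| ≤ Cmax * ‖u‖ * ‖v‖)
    (ha_coer : ∀ v : V, Cmin * ‖v‖ ^ 2 ≤ a v v)
    (he_bdd : ∀ θ r : Z, |e θ r| ≤ ‖θ‖ * ‖r‖)
    (he_coer : ∀ r : Z, ‖r‖ ^ 2 ≤ e r r)
    (hc_bdd : ∀ w u v : V, |c w u v| ≤ lam2 * ‖w‖ * ‖u‖ * ‖v‖)
    (hc_skew : ∀ w v : V, c w v v = 0)
    (hh_bdd : ∀ (w : V) (θ r : Z), |h w θ r| ≤ lam2 * ‖w‖ * ‖θ‖ * ‖r‖)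
    (hh_skew : ∀ (w : V) (r : Z), h w r r = 0)
    (hQ_bdd : ∀ (θ : Z) (v : V), |Q θ v| ≤ lamq * ‖θ‖ * ‖v‖)
    (hL_bdd : ∀ v : V, |L v| ≤ Lam * ‖v‖)
    (hPsi_bdd : ∀ r : Z, |Ψ r| ≤ lampsi * ‖r‖)
    (un : ℕ → V) (θn : ℕ → Z)
    (hstep_a : ∀ (n : ℕ) (v : V),
      a (un (n + 1)) v + c (un n) (un (n + 1)) v + Q (θn (n + 1)) v = L v)
    (hstep_e : ∀ (n : ℕ) (r : Z),
      e (θn (n + 1)) r + h (un n) (θn (n + 1)) r = Ψ r) :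
    ∀ n : ℕ, ‖θn (n + 1)‖ ≤ lampsi ∧ ‖un (n + 1)‖ ≤ ((Lam + lamq * lampsi) / Cmin) := by
  intro n
  have hθ : ‖θn (n + 1)‖ ≤ lampsi := by
    have hstep := hstep_e n (θn (n + 1))
    rw [hh_skew, add_zero] at hstep
    have hcoer := he_coer (θn (n + 1))
    have hΨ := (le_abs_self _).trans (hPsi_bdd (θn (n + 1)))
    simpa using le_div_of_mul_sq_le_mul one_pos hlampsi (norm_nonneg (θn (n + 1))) (by linarith)
  refine ⟨hθ, le_div_of_mul_sq_le_mul hCmin (by positivity) (norm_nonneg _) ?_⟩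
  have hstep := hstep_a n (un (n + 1))
  rw [hc_skew, add_zero] at hstep
  have hcoer := ha_coer (un (n + 1))
  have hL := (le_abs_self _).trans (hL_bdd (un (n + 1)))
  have hQ := (neg_le_abs _).trans (hQ_bdd (θn (n + 1)) (un (n + 1)))
  have hQθ : lamq * ‖θn (n + 1)‖ * ‖un (n + 1)‖ ≤ lamq * lampsi * ‖un (n + 1)‖ := by gcongr
  linarith
end
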